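/- Let l₁, l₂, l₃, l₄ be four distinct lines in Pic S₈ that pairwise intersect in 1, with center D = l₁ + l₂ + l₃ + l₄. Then there exists a root d with D + 4K = 2d if and only if there exists a line l with l·lᵢ = 0 for all i = 1, 2, 3, 4 (i.e., the A₃⁸(1)-polytope with center D is cornered). -/

import Mathlib

/-!
Picard lattice of the degree 1 del Pezzo surface S₈:
Pic S₈ = ℤh ⊕ ℤe₁ ⊕ ⋯ ⊕ ℤe₈ ≅ ℤ⁹, with intersection pairing
h·h = 1, h·eᵢ = 0, eᵢ·eⱼ = −δᵢⱼ, and canonical class K = −3h + e₁ + ⋯ + e₈.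
-/

namespace DelPezzo

/-- The Picard lattice `Pic S₈ ≅ ℤ⁹`; coordinate `0` is the `h`-coordinate and
coordinates `1,…,8` are the `e₁,…,e₈`-coordinates. -/
abbrev Pic : Type := Fin 9 → ℤ

/-- The intersection pairing on `Pic S₈` (signature `(1,-8)`). -/
def inter (x y : Pic) : ℤ := x 0 * y 0 - ∑ i : Fin 8, x i.succ * y i.succ

/-- The canonical class `K = -3h + e₁ + ⋯ + e₈`. -/
def K : Pic := fun i => if i = 0 then -3 else 1

/-- A line: a class `l` with `l·l = -1` and `l·K = -1`. -/
def IsLine (l : Pic) : Prop := inter l l = -1 ∧ inter l K = -1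

/-- A root: a class `d` with `d·d = -2` and `d·K = 0`. -/
def IsRoot (d : Pic) : Prop := inter d d = -2 ∧ inter d K = 0

theorem inter_comm (x y : Pic) : inter x y = inter y x := by
  simp only [inter, mul_comm]

theorem inter_add_left (x y z : Pic) : inter (x + y) z = inter x z + inter y z := by
  simp only [inter, Pi.add_apply, add_mul, Finset.sum_add_distrib]
  ring

theorem inter_sub_left (x y z : Pic) : inter (x - y) z = inter x z - inter y z := by
  simp only [inter, Pi.sub_apply, sub_mul, Finset.sum_sub_distrib]
  ring

theorem inter_nsmul_left (n : ℕ) (x z : Pic) : inter (n • x) z = n * inter x z := by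
  simp only [inter, Pi.smul_apply, nsmul_eq_mul, mul_sub, Finset.mul_sum, mul_assoc]

theorem inter_add_right (x y z : Pic) : inter x (y + z) = inter x y + inter x z := by
  simp only [inter_comm x, inter_add_left]

theorem inter_sub_right (x y z : Pic) : inter x (y - z) = inter x y - inter x z := by
  simp only [inter_comm x, inter_sub_left]

theorem inter_nsmul_right (n : ℕ) (x z : Pic) : inter x (n • z) = n * inter x z := by
  simp only [inter_comm x, inter_nsmul_left]

theorem inter_K_K : inter K K = 1 := by decide

/-- The pairing is anisotropic on the orthogonal complement of `K`. -/
theorem eq_zero_of_inter_self_eq_zero {x : Pic} (hx : inter x x = 0) (hK : inter x K = 0) :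
    x = 0 := by
  have hsum : ∑ i : Fin 8, x i.succ = -3 * x 0 := by
    simp only [inter, K, if_true, Fin.succ_ne_zero, if_false, mul_one] at hK
    linarith
  have hsq : ∑ i : Fin 8, x i.succ ^ 2 = x 0 ^ 2 := by
    simp only [inter, ← sq] at hx
    linarith
  have hcs := sq_sum_le_card_mul_sum_sq (s := Finset.univ) (f := fun i : Fin 8 => x i.succ)
  rw [hsum, hsq, Finset.card_univ, Fintype.card_fin] at hcs
  push_cast at hcs
  have h0 : x 0 = 0 := pow_eq_zero_iff two_ne_zero |>.mp (by nlinarith [sq_nonneg (x 0)])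
  rw [h0, zero_pow two_ne_zero, Finset.sum_eq_zero_iff_of_nonneg fun i _ => sq_nonneg _] at hsq
  ext i
  refine Fin.cases h0 (fun j => ?_) i
  exact pow_eq_zero_iff two_ne_zero |>.mp (hsq j (Finset.mem_univ j))

theorem cornered_iff_root (l : Fin 4 → Pic) (hinj : Function.Injective l)
    (hline : ∀ i, IsLine (l i))
    (hint : ∀ i j, i ≠ j → inter (l i) (l j) = 1) :
    (∃ d : Pic, IsRoot d ∧ (∑ i, l i) + 4 • K = 2 • d) ↔
      (∃ m : Pic, IsLine m ∧ ∀ i, inter m (l i) = 0) := by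
  have hKl : ∀ i, inter K (l i) = -1 := fun i => by rw [inter_comm, (hline i).2]
  have hlK : ∀ i, inter (l i) K = -1 := fun i => (hline i).2
  have hsl : ∀ i, inter (∑ j, l j) (l i) = 2 := by
    have hll : ∀ i, inter (l i) (l i) = -1 := fun i => (hline i).1
    intro i
    fin_cases i <;> simp [Fin.sum_univ_four, inter_add_left, hll, hint]
  have hsK : inter (∑ j, l j) K = -4 := by
    simp [Fin.sum_univ_four, inter_add_left, hlK]
  have hss : inter (∑ j, l j) (∑ j, l j) = 8 := by
    rw [Fin.sum_univ_four l, inter_add_right, inter_add_right, inter_add_right,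
      ← Fin.sum_univ_four l]
    simp only [hsl]
    norm_num
  constructor
  · rintro ⟨d, ⟨hdd, hdK⟩, hd⟩
    have hKd : inter K d = 0 := by rw [inter_comm, hdK]
    refine ⟨d - K, ⟨?_, ?_⟩, fun i => ?_⟩
    · simp [inter_sub_left, inter_sub_right, hdd, hdK, hKd, inter_K_K]
    · simp [inter_sub_left, hdK, inter_K_K]
    · have h := congrArg (inter · (l i)) hd
      simp only [inter_add_left, inter_nsmul_left, hsl, hKl] at h
      rw [inter_sub_left, hKl]
      push_cast at h
      linarith
  · rintro ⟨m, ⟨hmm, hmK⟩, hm⟩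
    have hKm : inter K m = -1 := by rw [inter_comm, hmK]
    have hms : inter m (∑ j, l j) = 0 := by
      simp [Fin.sum_univ_four, inter_add_right, hm]
    have hsm : inter (∑ j, l j) m = 0 := by rw [inter_comm, hms]
    have hKs : inter K (∑ j, l j) = -4 := by rw [inter_comm, hsK]
    refine ⟨m + K, ⟨?_, ?_⟩, sub_eq_zero.mp (eq_zero_of_inter_self_eq_zero ?_ ?_)⟩ <;>
      simp only [inter_add_left, inter_add_right, inter_sub_left, inter_sub_right,
        inter_nsmul_left, inter_nsmul_right, hmm, hmK, hKm, hms, hsm, hsK, hKs, hss,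
        inter_K_K] <;>
      norm_num

end DelPezzo
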